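/- Let (W, S) be a finite Coxeter group. Then the alternating sum of induced sign/trivial characters satisfies Σ_{I ⊆ S} (-1)^{|I|} Ind_{W_I}^{W} 1 = sgn, the sign character of W, as an identity of virtual characters. -/

import Mathlib

section DoubleCosetAction

variable {G : Type*} [Group G]

/-- The action of `H × K` on `G` by left and right translations, whose orbits are the double
cosets of `H` and `K`. -/
abbrev doubleCosetAction (H K : Subgroup G) : MulAction (H × K) G where
  smul p z := p.1 * z * (p.2 : G)⁻¹
  one_smul z := show ((1 : H) : G) * z * ((1 : K) : G)⁻¹ = z by simp
  mul_smul p q z := show ((p.1 * q.1 : H) : G) * z * ((p.2 * q.2 : K) : G)⁻¹ =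
    p.1 * (q.1 * z * (q.2 : G)⁻¹) * (p.2 : G)⁻¹ by simp [mul_assoc]

/-- Pairs of points of `G` conjugating the same element into `H` and into `K`, in terms of the
fixed points of the double coset action. -/
def conjPairsEquiv (H K : Subgroup G) :
    letI := doubleCosetAction H K
    (Σ w : G, {x : G // x⁻¹ * w * x ∈ H} × {y : G // y⁻¹ * w * y ∈ K}) ≃
      G × Σ p : H × K, MulAction.fixedBy G p :=
  letI := doubleCosetAction H K
  { toFun := fun q ↦ (q.2.1, ⟨(⟨_, q.2.1.2⟩, ⟨_, q.2.2.2⟩), ⟨(q.2.1 : G)⁻¹ * q.2.2, by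
      change (q.2.1 : G)⁻¹ * q.1 * q.2.1 * ((q.2.1 : G)⁻¹ * q.2.2) *
        ((q.2.2 : G)⁻¹ * q.1 * q.2.2)⁻¹ = (q.2.1 : G)⁻¹ * q.2.2
      group⟩⟩)
    invFun := fun q ↦ ⟨q.1 * q.2.1.1 * q.1⁻¹, ⟨q.1, by simp [mul_assoc]⟩,
      ⟨q.1 * q.2.2, by
        have h : q.2.1.1 * (q.2.2 : G) * (q.2.1.2 : G)⁻¹ = q.2.2 := q.2.2.2
        rw [show (q.1 * (q.2.2 : G))⁻¹ * (q.1 * q.2.1.1 * q.1⁻¹) * (q.1 * q.2.2) =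
          (q.2.2 : G)⁻¹ * (q.2.1.1 * q.2.2) by group, mul_inv_eq_iff_eq_mul.1 h]
        simp⟩⟩
    left_inv := by
      rintro ⟨w, ⟨x, hx⟩, ⟨y, hy⟩⟩
      have hw : x * (x⁻¹ * w * x) * x⁻¹ = w := by group
      have hxy : x * (x⁻¹ * y) = y := by group
      dsimp only
      congr! 3
      all_goals simp only [hw]
    right_inv := by
      rintro ⟨x, ⟨⟨a, ha⟩, ⟨b, hb⟩⟩, ⟨z, hz⟩⟩
      have h : a * z * b⁻¹ = z := hz
      have h₁ : x⁻¹ * (x * a * x⁻¹) * x = a := by group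
      have h₂ : (x * z)⁻¹ * (x * a * x⁻¹) * (x * z) = b := by
        rw [show (x * z)⁻¹ * (x * a * x⁻¹) * (x * z) = z⁻¹ * (a * z) by group,
          mul_inv_eq_iff_eq_mul.1 h]
        simp
      have h₃ : x⁻¹ * (x * z) = z := by group
      dsimp only
      congr! 3
      all_goals simp_all }

theorem sum_card_conj_mul_card_conj [Fintype G] (H K : Subgroup G) :
    ∑ w : G, Nat.card {x : G // x⁻¹ * w * x ∈ H} * Nat.card {y : G // y⁻¹ * w * y ∈ K} =
      Nat.card G * (Nat.card (Quotient (doubleCosetAction H K).orbitRel) *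
        (Nat.card H * Nat.card K)) := by
  let := doubleCosetAction H K
  rw [← Nat.card_prod H K, ← Nat.card_prod, ← Nat.card_congr
    (MulAction.sigmaFixedByEquivOrbitsProdGroup (H × K) G), ← Nat.card_prod,
    ← Nat.card_congr (conjPairsEquiv H K), Nat.card_sigma]
  simp [Nat.card_prod]

theorem sum_card_conj_mul [Fintype G] (H : Subgroup G) [Fintype H] {R : Type*} [CommRing R]
    (f : G →* R) :
    ∑ w : G, (Nat.card {x : G // x⁻¹ * w * x ∈ H} : R) * f w =
      Nat.card G * ∑ h : H, f h := by
  classical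
  calc ∑ w : G, (Nat.card {x : G // x⁻¹ * w * x ∈ H} : R) * f w
      = ∑ w : G, ∑ x : G, if x⁻¹ * w * x ∈ H then f w else 0 := by
        refine Finset.sum_congr rfl fun w _ ↦ ?_
        rw [← Finset.sum_filter, Finset.sum_const, nsmul_eq_mul, Nat.card_eq_fintype_card,
          Fintype.card_subtype]
    _ = ∑ x : G, ∑ w : G, if x⁻¹ * w * x ∈ H then f w else 0 := Finset.sum_comm
    _ = ∑ x : G, ∑ h : H, f h := by
        refine Finset.sum_congr rfl fun x _ ↦ ?_
        have hconj (w : G) : f x * (f w * f x⁻¹) = f w := by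
          rw [mul_left_comm, ← map_mul, mul_inv_cancel, map_one, mul_one]
        rw [← Equiv.sum_comp (MulAut.conj x).toEquiv,
          ← Finset.sum_subtype (Finset.univ.filter (· ∈ H)) (by simp) f, Finset.sum_filter]
        refine Finset.sum_congr rfl fun w _ ↦ ?_
        simp [hconj, mul_assoc]
    _ = _ := by simp [Nat.card_eq_fintype_card]

end DoubleCosetAction

namespace CoxeterSystem

variable {B W : Type*} [Group W] {M : CoxeterMatrix B} (cs : CoxeterSystem M W)

section Exchange

theorem end_mul_apply {α : Type*} (f g : Function.End α) (x : α) : (f * g) x = f (g x) := rfl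

open Classical in
/-- The action of the generator `i` on pairs consisting of a group element and a parity:
conjugation by `s i`, switching the parity at `s i` itself. -/
noncomputable def signedConj (i : B) : Function.End (W × ZMod 2) := fun p ↦
  (cs.simple i * p.1 * cs.simple i, p.2 + if p.1 = cs.simple i then 1 else 0)

open Classical in
theorem signedConj_mul_pow (i j : B) (n : ℕ) (t : W) (e : ZMod 2) :
    ((cs.signedConj i * cs.signedConj j) ^ n) (t, e) =
      ((cs.simple i * cs.simple j) ^ n * t * ((cs.simple i * cs.simple j) ^ n)⁻¹,
        e + ∑ l ∈ Finset.range (2 * n),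
          if t = cs.simple j * (cs.simple i * cs.simple j) ^ l then 1 else 0) := by
  induction n with
  | zero => simp [Function.End.one_def]
  | succ n ih =>
    rw [pow_succ', end_mul_apply, ih, end_mul_apply]
    set r := cs.simple i * cs.simple j with hr
    have hj : cs.simple j * cs.simple j = 1 := cs.simple_mul_simple_self j
    have hrinv : cs.simple j * r * cs.simple j = r⁻¹ := by simp [hr, mul_assoc]
    have hrn (k : ℕ) : (r ^ k)⁻¹ * cs.simple j = cs.simple j * r ^ k := by
      have h : (cs.simple j * r * (cs.simple j)⁻¹) ^ k = cs.simple j * r ^ k * (cs.simple j)⁻¹ :=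
        conj_pow
      rw [cs.inv_simple, hrinv, inv_pow] at h
      rw [h, mul_assoc, hj, mul_one]
    have h₁ : r ^ n * t * (r ^ n)⁻¹ = cs.simple j ↔ t = cs.simple j * r ^ (2 * n) := by
      rw [two_mul, pow_add, ← mul_assoc, ← hrn n, mul_inv_eq_iff_eq_mul, mul_assoc,
        eq_inv_mul_iff_mul_eq]
    have h₂ : cs.simple j * (r ^ n * t * (r ^ n)⁻¹) * cs.simple j = cs.simple i ↔
        t = cs.simple j * r ^ (2 * n + 1) := by
      have : cs.simple j * r ^ (2 * n + 1) =
          (r ^ n)⁻¹ * (cs.simple j * cs.simple i * cs.simple j) * r ^ n := by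
        rw [show 2 * n + 1 = n + 1 + n by ring, pow_add, pow_succ, ← mul_assoc, ← mul_assoc,
          ← hrn n]
        simp [hr, mul_assoc]
      rw [this]
      constructor
      · intro h
        rw [← h]
        simp [mul_assoc]
      · rintro rfl
        simp [mul_assoc]
    simp only [signedConj, h₁, h₂, Prod.mk.injEq]
    constructor
    · rw [pow_succ']
      simp [hr, mul_assoc]
    · rw [show 2 * (n + 1) = 2 * n + 1 + 1 by ring, Finset.sum_range_succ, Finset.sum_range_succ]
      ring

theorem isLiftable_signedConj : M.IsLiftable cs.signedConj := by
  classical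
  intro i j
  funext ⟨t, e⟩
  rw [signedConj_mul_pow, two_mul, Finset.sum_range_add]
  simp [pow_add, CharTwo.add_self_eq_zero, Function.End.one_def]

/-- The action of `W` on pairs of a group element and a parity, extending `signedConj`. -/
noncomputable def signedConjHom : W →* Function.End (W × ZMod 2) :=
  cs.lift ⟨cs.signedConj, cs.isLiftable_signedConj⟩

theorem signedConjHom_simple (i : B) : cs.signedConjHom (cs.simple i) = cs.signedConj i :=
  cs.lift_apply_simple cs.isLiftable_signedConj i

open Classical in
theorem signedConjHom_wordProd (ω : List B) (t : W) (e : ZMod 2) :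
    cs.signedConjHom (cs.wordProd ω) (t, e) =
      (cs.wordProd ω * t * (cs.wordProd ω)⁻¹, e + (cs.rightInvSeq ω).count t) := by
  induction ω with
  | nil => simp [Function.End.one_def]
  | cons i ω ih =>
    rw [wordProd_cons, map_mul, end_mul_apply, ih,
      signedConjHom_simple]
    simp only [signedConj, rightInvSeq, List.count_cons, Prod.mk.injEq, mul_inv_rev, inv_simple,
      mul_assoc, true_and, Nat.cast_add, Nat.cast_ite, Nat.cast_one, Nat.cast_zero, beq_iff_eq,
      add_assoc]
    congr 3
    apply propext
    constructor
    · intro h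
      rw [← h]
      group
    · intro h
      rw [← h]
      group

open Classical in
theorem isRightDescent_iff_signedConjHom {w : W} {i : B} :
    cs.IsRightDescent w i ↔ (cs.signedConjHom w (cs.simple i, 0)).2 = 1 := by
  have key : ∀ v : W, (cs.signedConjHom v (cs.simple i, 0)).2 ≠ 0 → cs.IsRightDescent v i := by
    intro v hv
    obtain ⟨ω, hω, rfl⟩ := cs.exists_isReduced v
    rw [signedConjHom_wordProd] at hv
    have hmem : cs.simple i ∈ cs.rightInvSeq ω := by
      by_contra h
      simp [List.count_eq_zero_of_not_mem h] at hv
    exact (cs.isRightInversion_of_mem_rightInvSeq hω hmem).2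
  refine ⟨fun h ↦ ?_, fun h ↦ key w (by simp [h])⟩
  by_contra hne
  have h0 : (cs.signedConjHom w (cs.simple i, 0)).2 = 0 := by
    revert hne
    generalize (cs.signedConjHom w (cs.simple i, 0)).2 = a
    revert a
    decide
  refine (cs.isRightDescent_iff_not_isRightDescent_mul.1 h) (key _ ?_)
  obtain ⟨ω, rfl⟩ := cs.wordProd_surjective w
  rw [map_mul, end_mul_apply, signedConjHom_simple]
  rw [signedConjHom_wordProd] at h0
  simp only [zero_add] at h0
  simp [signedConj, signedConjHom_wordProd, h0]

theorem simple_mul_eq_mul_simple {w : W} {i j : B} (h : ¬ cs.IsRightDescent w i)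
    (h' : cs.IsRightDescent (cs.simple j * w) i) :
    cs.simple j * w = w * cs.simple i := by
  classical
  rw [isRightDescent_iff_signedConjHom] at h h'
  obtain ⟨ω, rfl⟩ := cs.wordProd_surjective w
  rw [map_mul, end_mul_apply, signedConjHom_simple] at h'
  rw [signedConjHom_wordProd] at h h'
  simp only [signedConj] at h h'
  split_ifs at h' with hc
  · rw [← hc]
    group
  · simp_all

/-- The exchange property. -/
theorem exists_sublist_of_isRightDescent (ω : List B) {u : W} {i : B}
    (h : ¬ cs.IsRightDescent u i) (h' : cs.IsRightDescent (cs.wordProd ω * u) i) :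
    ∃ ω' : List B, ω'.Sublist ω ∧ ω'.length + 1 = ω.length ∧
      cs.wordProd ω * u * cs.simple i = cs.wordProd ω' * u := by
  induction ω with
  | nil => simp_all
  | cons j ω ih =>
    rw [wordProd_cons, mul_assoc] at h'
    by_cases hω : cs.IsRightDescent (cs.wordProd ω * u) i
    · obtain ⟨ω', hs, hl, he⟩ := ih hω
      refine ⟨j :: ω', hs.cons_cons j, by simp [hl], ?_⟩
      simp only [wordProd_cons, mul_assoc] at he ⊢
      rw [he]
    · refine ⟨ω, List.sublist_cons_self j ω, by simp, ?_⟩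
      rw [wordProd_cons, mul_assoc (cs.simple j), cs.simple_mul_eq_mul_simple hω h']
      simp

theorem exists_sublist_of_isLeftDescent {ω : List B} {i : B}
    (h : cs.IsLeftDescent (cs.wordProd ω) i) :
    ∃ ω' : List B, ω'.Sublist ω ∧ ω'.length + 1 = ω.length ∧
      cs.simple i * cs.wordProd ω = cs.wordProd ω' := by
  rw [← isRightDescent_inv_iff, ← wordProd_reverse] at h
  obtain ⟨ω', hs, hl, he⟩ := cs.exists_sublist_of_isRightDescent ω.reverse
    (cs.not_isRightDescent_one i) (by simpa using h)
  refine ⟨ω'.reverse, by simpa using hs.reverse, by simpa using hl, ?_⟩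
  rw [wordProd_reverse, ← inv_inj, inv_inv]
  simpa using he

end Exchange

section Longest

theorem exists_mul_eq_of_forall_isRightDescent {w : W} (hw : ∀ i, cs.IsRightDescent w i) (v : W) :
    ∃ x, w = x * v ∧ cs.length x + cs.length v ≤ cs.length w := by
  induction hn : cs.length v generalizing v with
  | zero => exact ⟨w, by simp [cs.length_eq_zero_iff.1 hn]⟩
  | succ n ih =>
    obtain ⟨i, hi⟩ := cs.exists_rightDescent_of_ne_one (w := v) (by rintro rfl; simp at hn)
    have hlen := cs.isRightDescent_iff.1 hi
    obtain ⟨x, rfl, hx⟩ := ih (v * cs.simple i) (by omega)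
    obtain ⟨ω, hω, rfl⟩ := cs.exists_isReduced x
    obtain ⟨ω', -, hl, he⟩ := cs.exists_sublist_of_isRightDescent ω
      (cs.isRightDescent_iff_not_isRightDescent_mul.1 hi) (hw i)
    refine ⟨cs.wordProd ω', mul_right_cancel (b := cs.simple i) (by rw [he, mul_assoc]), ?_⟩
    have := cs.length_wordProd_le ω'
    have := hω.eq
    omega

theorem eq_of_forall_isRightDescent {w v : W} (hw : ∀ i, cs.IsRightDescent w i)
    (hv : ∀ i, cs.IsRightDescent v i) : w = v := by
  obtain ⟨x, hx, hxl⟩ := cs.exists_mul_eq_of_forall_isRightDescent hw v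
  obtain ⟨y, -, hyl⟩ := cs.exists_mul_eq_of_forall_isRightDescent hv w
  rw [hx, cs.length_eq_zero_iff.1 (show cs.length x = 0 by omega), one_mul]

theorem exists_forall_isDescent [Finite W] :
    ∃ w : W, (∀ i, cs.IsLeftDescent w i) ∧ ∀ i, cs.IsRightDescent w i := by
  obtain ⟨w, hw⟩ := Finite.exists_max cs.length
  exact ⟨w, fun i ↦ (hw _).lt_of_ne (cs.length_simple_mul_ne w i),
    fun i ↦ (hw _).lt_of_ne (cs.length_mul_simple_ne w i)⟩

theorem card_forall_isDescent [Finite W] :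
    Nat.card {w : W // (∀ i, cs.IsLeftDescent w i) ∧ ∀ i, cs.IsRightDescent w i} = 1 := by
  obtain ⟨w, hw⟩ := cs.exists_forall_isDescent
  rw [Nat.card_eq_one_iff_unique]
  exact ⟨⟨fun a b ↦ Subtype.ext (cs.eq_of_forall_isRightDescent a.2.2 b.2.2)⟩, ⟨⟨w, hw⟩⟩⟩

end Longest

section Parabolic

/-- The standard parabolic subgroup generated by the simple reflections indexed by `I`. -/
abbrev parabolic (I : Set B) : Subgroup W := Subgroup.closure (cs.simple '' I)

theorem simple_mem_parabolic {I : Set B} {i : B} (hi : i ∈ I) : cs.simple i ∈ cs.parabolic I :=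
  Subgroup.subset_closure ⟨i, hi, rfl⟩

theorem mem_parabolic_iff {I : Set B} {w : W} :
    w ∈ cs.parabolic I ↔ ∃ ω : List B, (∀ i ∈ ω, i ∈ I) ∧ cs.wordProd ω = w := by
  constructor
  · intro h
    induction h using Subgroup.closure_induction with
    | mem x hx =>
      obtain ⟨i, hi, rfl⟩ := hx
      exact ⟨[i], by simpa using hi, by simp⟩
    | one => exact ⟨[], by simp⟩
    | mul x y _ _ hx hy =>
      obtain ⟨ω, h, rfl⟩ := hx
      obtain ⟨ω', h', rfl⟩ := hy
      exact ⟨ω ++ ω', by simpa [or_imp, forall_and] using ⟨h, h'⟩, cs.wordProd_append _ _⟩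
    | inv x _ hx =>
      obtain ⟨ω, h, rfl⟩ := hx
      exact ⟨ω.reverse, by simpa using h, cs.wordProd_reverse ω⟩
  · rintro ⟨ω, h, rfl⟩
    refine Subgroup.list_prod_mem _ fun x hx ↦ ?_
    obtain ⟨i, hi, rfl⟩ := List.mem_map.1 hx
    exact cs.simple_mem_parabolic (h i hi)

/-- `w` has no left descent in `I` and no right descent in `J`. -/
def IsBireduced (I J : Set B) (w : W) : Prop :=
  (∀ i ∈ I, ¬ cs.IsLeftDescent w i) ∧ ∀ j ∈ J, ¬ cs.IsRightDescent w j

theorem isBireduced_of_forall_length_le {I J : Set B} {d : W}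
    (hd : ∀ a ∈ cs.parabolic I, ∀ b ∈ cs.parabolic J, cs.length d ≤ cs.length (a * d * b)) :
    cs.IsBireduced I J d := by
  constructor
  · intro i hi
    simpa [IsLeftDescent] using hd _ (cs.simple_mem_parabolic hi) 1 (one_mem _)
  · intro j hj
    simpa [IsRightDescent] using hd 1 (one_mem _) _ (cs.simple_mem_parabolic hj)

theorem eq_of_isBireduced_of_forall_length_le {I J : Set B} {d d' : W}
    (hd : ∀ a ∈ cs.parabolic I, ∀ b ∈ cs.parabolic J, cs.length d ≤ cs.length (a * d * b))
    (hd' : cs.IsBireduced I J d') {a b : W} (ha : a ∈ cs.parabolic I) (hb : b ∈ cs.parabolic J)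
    (h : a * d * b = d') : d' = d := by
  obtain ⟨α, hα, rfl⟩ := cs.mem_parabolic_iff.1 ha
  obtain ⟨β, hβ, rfl⟩ := cs.mem_parabolic_iff.1 hb
  clear ha hb
  obtain ⟨δ, hδ, hdδ⟩ := cs.exists_isReduced d
  induction hn : α.length + β.length using Nat.strong_induction_on generalizing α β δ with
  | _ n ih =>
    have hle : ∀ α' β' δ' : List B, (∀ i ∈ α', i ∈ I) → (∀ j ∈ β', j ∈ J) →
        cs.wordProd α' * cs.wordProd δ' * cs.wordProd β' = d' → δ.length ≤ δ'.length := by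
      intro α' β' δ' hα' hβ' h'
      have := hd ((cs.wordProd α')⁻¹ * cs.wordProd α)
        (mul_mem (inv_mem (cs.mem_parabolic_iff.2 ⟨_, hα', rfl⟩))
          (cs.mem_parabolic_iff.2 ⟨_, hα, rfl⟩))
        (cs.wordProd β * (cs.wordProd β')⁻¹)
        (mul_mem (cs.mem_parabolic_iff.2 ⟨_, hβ, rfl⟩)
          (inv_mem (cs.mem_parabolic_iff.2 ⟨_, hβ', rfl⟩)))
      have he : (cs.wordProd α')⁻¹ * cs.wordProd α * d * (cs.wordProd β * (cs.wordProd β')⁻¹)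
          = cs.wordProd δ' := by
        rw [show (cs.wordProd α')⁻¹ * cs.wordProd α * d * (cs.wordProd β * (cs.wordProd β')⁻¹)
          = (cs.wordProd α')⁻¹ * (cs.wordProd α * d * cs.wordProd β) * (cs.wordProd β')⁻¹ by group,
          h, ← h']
        group
      rw [he, hdδ, hδ.eq] at this
      exact this.trans (cs.length_wordProd_le δ')
    have step : ∀ α₀ β₀ ω : List B, (∀ i ∈ α₀, i ∈ I) → (∀ j ∈ β₀, j ∈ J) →
        α₀.length + β₀.length + 1 = n → ω.Sublist (α₀ ++ δ ++ β₀) →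
        ω.length + 1 = (α₀ ++ δ ++ β₀).length → cs.wordProd ω = d' → d' = d := by
      intro α₀ β₀ ω hα₀ hβ₀ hn₀ hs hl he
      obtain ⟨ω₁, β', rfl, hs₁, hβ'⟩ := List.sublist_append_iff.1 hs
      obtain ⟨α', δ', rfl, hα', hδ'⟩ := List.sublist_append_iff.1 hs₁
      rw [wordProd_append, wordProd_append] at he
      have hα'' := fun i hi ↦ hα₀ i (hα'.subset hi)
      have hβ'' := fun i hi ↦ hβ₀ i (hβ'.subset hi)
      have hδδ : δ' = δ := hδ'.eq_of_length_le (hle _ _ _ hα'' hβ'' he)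
      subst hδδ
      simp only [List.length_append] at hl
      exact ih _ (by omega) _ hα'' _ hβ'' (by rw [hdδ, he]) _ hδ hdδ rfl
    rcases List.eq_nil_or_concat' β with rfl | ⟨β₀, j, rfl⟩
    · rcases α with _ | ⟨i, α₀⟩
      · simpa using h.symm
      · have hd₁ : cs.simple i * d' = cs.wordProd (α₀ ++ δ ++ []) := by
          rw [← h, hdδ]
          simp [wordProd_cons, wordProd_append, mul_assoc]
        have hdesc : cs.IsLeftDescent (cs.wordProd (α₀ ++ δ ++ [])) i := by
          rw [← hd₁, isLeftDescent_iff_not_isLeftDescent_mul]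
          simpa using hd'.1 i (hα i (by simp))
        obtain ⟨ω, hs, hl, he⟩ := cs.exists_sublist_of_isLeftDescent hdesc
        refine step α₀ [] ω (fun k hk ↦ hα k (by simp [hk])) hβ (by simp at hn ⊢; omega) hs hl ?_
        rw [← he, ← hd₁]
        simp
    · have hd₁ : d' * cs.simple j = cs.wordProd (α ++ δ ++ β₀) := by
        rw [← h, hdδ]
        simp [wordProd_append, mul_assoc]
      have hdesc : cs.IsRightDescent (cs.wordProd (α ++ δ ++ β₀) * 1) j := by
        rw [mul_one, ← hd₁, isRightDescent_iff_not_isRightDescent_mul]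
        simpa using hd'.2 j (hβ j (by simp))
      obtain ⟨ω, hs, hl, he⟩ :=
        cs.exists_sublist_of_isRightDescent _ (cs.not_isRightDescent_one j) hdesc
      refine step α β₀ ω hα (fun k hk ↦ hβ k (by simp [hk])) (by simp at hn ⊢; omega) hs hl ?_
      rw [mul_one, mul_one, ← hd₁] at he
      simpa using he.symm

end Parabolic

section Characters

/-- The sign character. -/
def signHom : W →* ℚ := cs.lift ⟨fun _ ↦ -1, fun i j ↦ by simp⟩

theorem signHom_simple (i : B) : cs.signHom (cs.simple i) = -1 :=
  cs.lift_apply_simple (f := fun _ ↦ (-1 : ℚ)) (fun i j ↦ by simp) i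

theorem signHom_eq_neg_one_pow_length (w : W) : cs.signHom w = (-1) ^ cs.length w := by
  obtain ⟨ω, hω, rfl⟩ := cs.exists_isReduced w
  rw [hω.eq, wordProd, map_list_prod, List.map_map]
  simp [Function.comp_def, signHom_simple]

open Classical in
theorem sum_signHom_parabolic (I : Finset B) [Fintype (cs.parabolic (I : Set B))] :
    ∑ w : cs.parabolic (I : Set B), cs.signHom w = if I = ∅ then 1 else 0 := by
  split_ifs with h
  · subst h
    have : ∀ w : cs.parabolic ((∅ : Finset B) : Set B), cs.signHom w = 1 := by
      rintro ⟨w, hw⟩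
      have : w = 1 := by simpa [parabolic] using hw
      simp [this]
    have hc : Fintype.card (cs.parabolic ((∅ : Finset B) : Set B)) = 1 := by
      rw [← Nat.card_eq_fintype_card]
      simp [parabolic]
    rw [Finset.sum_congr rfl fun w _ ↦ this w]
    simp [hc]
  · obtain ⟨i, hi⟩ := Finset.nonempty_iff_ne_empty.2 h
    have := Equiv.sum_comp (Equiv.mulLeft
      (⟨_, cs.simple_mem_parabolic hi⟩ : cs.parabolic (I : Set B))) fun w ↦ cs.signHom w
    simp [signHom_simple] at this
    linarith

theorem card_doubleCoset_parabolic [Finite W] (I J : Set B) :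
    Nat.card (Quotient (doubleCosetAction (cs.parabolic I) (cs.parabolic J)).orbitRel) =
      Nat.card {w : W // cs.IsBireduced I J w} := by
  let := doubleCosetAction (cs.parabolic I) (cs.parabolic J)
  have hex (w : W) : ∃ a ∈ cs.parabolic I, ∃ b ∈ cs.parabolic J,
      ∀ a' ∈ cs.parabolic I, ∀ b' ∈ cs.parabolic J,
        cs.length (a * w * b) ≤ cs.length (a' * (a * w * b) * b') := by
    obtain ⟨⟨a, b⟩, hab⟩ := Finite.exists_min
      fun p : cs.parabolic I × cs.parabolic J ↦ cs.length (p.1 * w * p.2)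
    refine ⟨a, a.2, b, b.2, fun a' ha' b' hb' ↦ ?_⟩
    simpa [mul_assoc] using hab (⟨a', ha'⟩ * a, b * ⟨b', hb'⟩)
  symm
  refine Nat.card_congr (Equiv.ofBijective
    (fun d ↦ Quotient.mk (MulAction.orbitRel _ W) d.1) ⟨?_, ?_⟩)
  · rintro ⟨d, hd⟩ ⟨d', hd'⟩ h
    obtain ⟨⟨⟨u, hu⟩, ⟨v, hv⟩⟩, huv⟩ := Quotient.exact h
    replace huv : u * d' * v⁻¹ = d := huv
    obtain ⟨a, ha, b, hb, hmin⟩ := hex d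
    have h₁ := cs.eq_of_isBireduced_of_forall_length_le hmin hd (inv_mem ha) (inv_mem hb) (by group)
    have h₂ := cs.eq_of_isBireduced_of_forall_length_le hmin hd' (mul_mem (inv_mem hu) (inv_mem ha))
      (mul_mem (inv_mem hb) hv) (by rw [← huv]; group)
    exact Subtype.ext (h₁.trans h₂.symm)
  · intro q
    induction q using Quotient.inductionOn with
    | _ w =>
      obtain ⟨a, ha, b, hb, hmin⟩ := hex w
      refine ⟨⟨_, cs.isBireduced_of_forall_length_le hmin⟩, Quotient.sound ?_⟩
      refine ⟨(⟨a, ha⟩, ⟨b⁻¹, inv_mem hb⟩), ?_⟩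
      change a * w * b⁻¹⁻¹ = a * w * b
      rw [inv_inv]

/-- The value at `w` of the character of `W` induced from the trivial character of `W_I`. -/
noncomputable def inducedTrivial (I : Finset B) (w : W) : ℚ :=
  Nat.card {x : W // x⁻¹ * w * x ∈ cs.parabolic (I : Set B)} /
    Nat.card (cs.parabolic (I : Set B))

theorem sum_inducedTrivial_mul_inducedTrivial [Fintype W] (I J : Finset B) :
    ∑ w, cs.inducedTrivial I w * cs.inducedTrivial J w =
      Nat.card W * Nat.card {w : W // cs.IsBireduced (I : Set B) (J : Set B) w} := by
  have h := congrArg (Nat.cast (R := ℚ))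
    (sum_card_conj_mul_card_conj (cs.parabolic (I : Set B)) (cs.parabolic (J : Set B)))
  rw [card_doubleCoset_parabolic] at h
  push_cast at h
  simp only [inducedTrivial, div_mul_div_comm, ← Finset.sum_div]
  rw [h, div_eq_iff (by simp [Nat.card_pos.ne'])]
  ring

open Classical in
theorem sum_inducedTrivial_mul_signHom [Fintype W] (I : Finset B) :
    ∑ w, cs.inducedTrivial I w * cs.signHom w = if I = ∅ then (Nat.card W : ℚ) else 0 := by
  have := Fintype.ofFinite (cs.parabolic (I : Set B))
  simp only [inducedTrivial, div_mul_eq_mul_div, ← Finset.sum_div]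
  rw [sum_card_conj_mul, sum_signHom_parabolic]
  split_ifs with h
  · subst h
    simp [parabolic]
  · simp

variable [Fintype B]

/-- The alternating sum of the characters induced from trivial characters. -/
noncomputable def alternatingInduced (w : W) : ℚ :=
  ∑ I : Finset B, (-1) ^ I.card * cs.inducedTrivial I w

theorem sum_alternatingInduced_mul_signHom [Fintype W] :
    ∑ w, cs.alternatingInduced w * cs.signHom w = Nat.card W := by
  classical
  simp only [alternatingInduced, Finset.sum_mul, mul_assoc]
  rw [Finset.sum_comm]
  simp [← Finset.mul_sum, sum_inducedTrivial_mul_signHom]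

open Classical in
theorem sum_neg_one_pow_mul_ite (p : B → Prop) :
    ∑ I : Finset B, (-1 : ℚ) ^ I.card * (if ∀ i ∈ I, ¬ p i then 1 else 0) =
      if ∀ i, p i then 1 else 0 := by
  have h := congrArg (Int.cast (R := ℚ))
    (Finset.sum_powerset_neg_one_pow_card (x := Finset.univ.filter fun i ↦ ¬ p i))
  have hs : (Finset.univ.filter fun i ↦ ¬ p i).powerset =
      Finset.univ.filter fun I : Finset B ↦ ∀ i ∈ I, ¬ p i := by
    ext I
    simp [Finset.subset_iff]
  rw [hs, Finset.sum_filter] at h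
  simpa [Finset.filter_eq_empty_iff] using h

theorem sum_alternatingInduced_mul_self [Fintype W] :
    ∑ w, cs.alternatingInduced w * cs.alternatingInduced w = Nat.card W := by
  classical
  have hcard (I J : Finset B) :
      (Nat.card {w : W // cs.IsBireduced (I : Set B) (J : Set B) w} : ℚ) =
      ∑ w : W, (if ∀ i ∈ I, ¬ cs.IsLeftDescent w i then 1 else 0) *
        (if ∀ i ∈ J, ¬ cs.IsRightDescent w i then 1 else 0) := by
    simp [Nat.card_eq_fintype_card, Fintype.card_subtype, IsBireduced, ← ite_and, and_comm]
  calc ∑ w, cs.alternatingInduced w * cs.alternatingInduced w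
      = ∑ I : Finset B, ∑ J : Finset B, (-1) ^ I.card * (-1) ^ J.card *
          ∑ w, cs.inducedTrivial I w * cs.inducedTrivial J w := by
        simp only [alternatingInduced, Finset.sum_mul_sum]
        simp only [Finset.mul_sum]
        rw [Finset.sum_comm]
        refine Finset.sum_congr rfl fun I _ ↦ ?_
        rw [Finset.sum_comm]
        exact Finset.sum_congr rfl fun J _ ↦ Finset.sum_congr rfl fun w _ ↦ by ring
    _ = Nat.card W * ∑ w : W,
          (∑ I : Finset B, (-1) ^ I.card * if ∀ i ∈ I, ¬ cs.IsLeftDescent w i then 1 else 0) *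
          ∑ J : Finset B, (-1) ^ J.card * if ∀ i ∈ J, ¬ cs.IsRightDescent w i then 1 else 0 := by
        simp only [sum_inducedTrivial_mul_inducedTrivial, hcard, Finset.sum_mul_sum]
        simp only [Finset.mul_sum]
        symm
        rw [Finset.sum_comm]
        refine Finset.sum_congr rfl fun I _ ↦ ?_
        rw [Finset.sum_comm]
        exact Finset.sum_congr rfl fun J _ ↦ Finset.sum_congr rfl fun w _ ↦ by ring
    _ = Nat.card W := by
        have h := cs.card_forall_isDescent
        simp only [Nat.card_eq_fintype_card, Fintype.card_subtype] at h
        simp only [sum_neg_one_pow_mul_ite]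
        simp [← ite_and, and_comm, h]

theorem alternatingInduced_eq_signHom [Finite W] (w : W) :
    cs.alternatingInduced w = cs.signHom w := by
  have := Fintype.ofFinite W
  have hsign : ∑ w, cs.signHom w * cs.signHom w = Nat.card W := by
    simp [signHom_eq_neg_one_pow_length, ← pow_add, ← two_mul, Nat.card_eq_fintype_card]
  have h : ∑ w, (cs.alternatingInduced w - cs.signHom w) ^ 2 = 0 := by
    calc ∑ w, (cs.alternatingInduced w - cs.signHom w) ^ 2
        = ∑ w, cs.alternatingInduced w * cs.alternatingInduced w -
          2 * ∑ w, cs.alternatingInduced w * cs.signHom w + ∑ w, cs.signHom w * cs.signHom w := by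
          rw [Finset.mul_sum, ← Finset.sum_sub_distrib, ← Finset.sum_add_distrib]
          exact Finset.sum_congr rfl fun w _ ↦ by ring
      _ = 0 := by
          rw [sum_alternatingInduced_mul_self, sum_alternatingInduced_mul_signHom, hsign]
          ring
  rw [Finset.sum_eq_zero_iff_of_nonneg fun _ _ ↦ sq_nonneg _] at h
  exact sub_eq_zero.1 (pow_eq_zero_iff two_ne_zero |>.1 (h w (Finset.mem_univ w)))

end Characters

end CoxeterSystem

/-- Solomon's formula: for a finite Coxeter group (W, S), the alternating sum of the
characters induced from the trivial characters of the standard parabolic subgroups W_I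
equals the sign character:  Σ_{I ⊆ S} (-1)^{|I|} Ind_{W_I}^W 1 = sgn, as an identity of
virtual characters (evaluated pointwise, using the induced character formula
(Ind_{W_I}^W 1)(w) = |{x ∈ W : x⁻¹ w x ∈ W_I}| / |W_I|). -/
theorem solomon_formula {B : Type*} [Fintype B] {W : Type*} [Group W] [Finite W]
    {M : CoxeterMatrix B} (cs : CoxeterSystem M W) :
    ∀ w : W,
      ∑ I ∈ Finset.powerset (Finset.univ : Finset B),
        (-1 : ℚ) ^ I.card *
          ((Nat.card {x : W // x⁻¹ * w * x ∈ Subgroup.closure (cs.simple '' (I : Set B))} : ℚ) /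
            (Nat.card (Subgroup.closure (cs.simple '' (I : Set B))) : ℚ)) =
      (-1 : ℚ) ^ cs.length w := by
  intro w
  rw [Finset.powerset_univ, ← cs.signHom_eq_neg_one_pow_length, ← cs.alternatingInduced_eq_signHom]
  rfl
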